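/- arXiv:1104.4223 — 2 statements merged into one kernel-verified Lean document; each statement's English description precedes it below -/
import Mathlib

section
/- Let (X, d) be a complete separable metric space and (φ, ψ) a convex-concave factorization of a ccc function θ. Then W_θ satisfies the triangle inequality on the whole space of Borel probability measures on X: for all Borel probability measures μ₁, μ₂, μ₃ on X, W_θ(μ₁, μ₃) ≤ W_θ(μ₁, μ₂) + W_θ(μ₂, μ₃). -/
open Set Function MeasureTheory Filter
open scoped ENNReal Topology

/-- A convex-concave factorization of `θ`. -/
structure CCFactorization (θ φ ψ : ℝ → ℝ) : Prop where
  phi_strictMono : StrictMonoOn φ (Set.Ici 0)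
  phi_continuous : ContinuousOn φ (Set.Ici 0)
  phi_zero : φ 0 = 0
  phi_mapsTo : Set.MapsTo φ (Set.Ici 0) (Set.Ici 0)
  phi_convex : ConvexOn ℝ (Set.Ici 0) φ
  psi_strictMono : StrictMonoOn ψ (Set.Ici 0)
  psi_continuous : ContinuousOn ψ (Set.Ici 0)
  psi_zero : ψ 0 = 0
  psi_mapsTo : Set.MapsTo ψ (Set.Ici 0) (Set.Ici 0)
  psi_concave : ConcaveOn ℝ (Set.Ici 0) ψ
  eq_comp : ∀ x ∈ Set.Ici (0:ℝ), θ x = φ (ψ x)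

/-- The set `Π(μ,ν)` of couplings of `μ` and `ν`: probability measures on `X × X` whose
marginals are `μ` and `ν`. -/
def Couplings {X : Type*} [MeasurableSpace X] (μ ν : MeasureTheory.Measure X) :
    Set (MeasureTheory.Measure (X × X)) :=
  {q | MeasureTheory.IsProbabilityMeasure q ∧
    q.map Prod.fst = μ ∧ q.map Prod.snd = ν}

/-- The `L^θ`-Wasserstein distance
`W_θ(μ,ν) = inf { t > 0 : inf_{q ∈ Π(μ,ν)} ∫ φ(ψ(d(x,y))/t) dq ≤ 1 }`
(with value `∞` if no such `t` exists). -/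
noncomputable def WTheta {X : Type*} [MetricSpace X] [MeasurableSpace X]
    (φ ψ : ℝ → ℝ) (μ ν : MeasureTheory.Measure X) : ℝ≥0∞ :=
  sInf {t : ℝ≥0∞ | 0 < t ∧ t ≠ ⊤ ∧
    (⨅ q ∈ Couplings μ ν,
      ∫⁻ p, ENNReal.ofReal (φ (ψ (dist p.1 p.2) / t.toReal)) ∂q) ≤ 1}

/-- Membership in the `L^θ`-Wasserstein space `P_θ(X)`: a Borel probability measure `μ` with
`∫ φ(ψ(d(x,y))/t) dμ(x) < ∞` for some `y ∈ X` and some `t ∈ (0,∞)`. -/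
def MemPTheta {X : Type*} [MetricSpace X] [MeasurableSpace X]
    (φ ψ : ℝ → ℝ) (μ : MeasureTheory.Measure X) : Prop :=
  MeasureTheory.IsProbabilityMeasure μ ∧
    ∃ y : X, ∃ t : ℝ, 0 < t ∧
      ∫⁻ x, ENNReal.ofReal (φ (ψ (dist x y) / t)) ∂μ < ⊤

/-- A concave nonnegative function on `[0, ∞)` is subadditive. -/
theorem ConcaveOn.add_le_of_nonneg {ψ : ℝ → ℝ} (hψ : ConcaveOn ℝ (Set.Ici 0) ψ)
    (h0 : 0 ≤ ψ 0) {a b : ℝ} (ha : 0 ≤ a) (hb : 0 ≤ b) : ψ (a + b) ≤ ψ a + ψ b := by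
  rcases (add_nonneg ha hb).eq_or_lt with h | h
  · obtain ⟨rfl, rfl⟩ := (add_eq_zero_iff_of_nonneg ha hb).1 h.symm
    simpa using h0
  have key : ∀ {x y : ℝ}, 0 ≤ x → 0 ≤ y → 0 < x + y → x / (x + y) * ψ (x + y) ≤ ψ x := by
    intro x y hx hy hxy
    have := hψ.2 (Set.mem_Ici.2 hxy.le) (Set.mem_Ici.2 le_rfl) (div_nonneg hx hxy.le)
      (div_nonneg hy hxy.le) (by field_simp)
    simp only [smul_eq_mul, mul_zero, add_zero, div_mul_cancel₀ _ hxy.ne'] at this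
    exact (le_add_of_nonneg_right (mul_nonneg (div_nonneg hy hxy.le) h0)).trans this
  have h₁ := key ha hb h
  have h₂ := key hb ha (add_comm a b ▸ h)
  rw [add_comm b a] at h₂
  calc ψ (a + b) = a / (a + b) * ψ (a + b) + b / (a + b) * ψ (a + b) := by field_simp
    _ ≤ ψ a + ψ b := add_le_add h₁ h₂

open scoped ProbabilityTheory in
/-- The gluing lemma: couplings of `(μ₁, μ₂)` and `(μ₂, μ₃)` are the marginals of a common
measure; here the middle variable is the first coordinate. -/
theorem exists_gluing {X : Type*} [MeasurableSpace X] [StandardBorelSpace X] [Nonempty X]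
    {μ₁ μ₂ μ₃ : Measure X} {q r : Measure (X × X)}
    (hq : q ∈ Couplings μ₁ μ₂) (hr : r ∈ Couplings μ₂ μ₃) :
    ∃ m : Measure (X × X × X),
      m.map (fun p => (p.2.1, p.1)) = q ∧ m.map (fun p => (p.1, p.2.2)) = r := by
  obtain ⟨hqp, -, hq₂⟩ := hq
  obtain ⟨hrp, hr₁, -⟩ := hr
  have hsw : IsProbabilityMeasure (q.map Prod.swap) :=
    Measure.isProbabilityMeasure_map measurable_swap.aemeasurable
  have hμ₂ : IsProbabilityMeasure μ₂ :=
    hr₁ ▸ Measure.isProbabilityMeasure_map measurable_fst.aemeasurable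
  have hq' : μ₂ ⊗ₘ (q.map Prod.swap).condKernel = q.map Prod.swap := by
    have := (q.map Prod.swap).disintegrate (q.map Prod.swap).condKernel
    rwa [Measure.fst_map_swap, Measure.snd, hq₂] at this
  have hr' : μ₂ ⊗ₘ r.condKernel = r := by
    have := r.disintegrate r.condKernel
    rwa [Measure.fst, hr₁] at this
  refine ⟨μ₂ ⊗ₘ ((q.map Prod.swap).condKernel ×ₖ r.condKernel), ?_, ?_⟩
  · rw [show (fun p : X × X × X => (p.2.1, p.1)) = Prod.swap ∘ Prod.map id Prod.fst from rfl,
      ← Measure.map_map (by fun_prop) (by fun_prop), ← Measure.compProd_map (by fun_prop),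
      ← ProbabilityTheory.Kernel.fst_eq, ProbabilityTheory.Kernel.fst_prod, hq',
      Measure.map_map (by fun_prop) (by fun_prop), Prod.swap_swap_eq, Measure.map_id]
  · rw [show (fun p : X × X × X => (p.1, p.2.2)) = Prod.map id Prod.snd from rfl,
      ← Measure.compProd_map (by fun_prop),
      ← ProbabilityTheory.Kernel.snd_eq, ProbabilityTheory.Kernel.snd_prod, hr']

namespace CCFactorization

variable {θ φ ψ : ℝ → ℝ}

theorem cost_nonneg (h : CCFactorization θ φ ψ) {t a : ℝ} (ht : 0 ≤ t) (ha : 0 ≤ a) :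
    0 ≤ φ (ψ a / t) :=
  h.phi_mapsTo (div_nonneg (h.psi_mapsTo ha) ht)

theorem measurable_cost (h : CCFactorization θ φ ψ) {X : Type*} [MetricSpace X]
    [SecondCountableTopology X] [MeasurableSpace X] [BorelSpace X] {t : ℝ} (ht : 0 ≤ t) :
    Measurable fun p : X × X => ENNReal.ofReal (φ (ψ (dist p.1 p.2) / t)) := by
  have hψ : Continuous fun p : X × X => ψ (dist p.1 p.2) :=
    h.psi_continuous.comp_continuous continuous_dist fun _ => dist_nonneg
  exact (h.phi_continuous.comp_continuous (hψ.div_const t) fun _ =>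
    div_nonneg (h.psi_mapsTo dist_nonneg) ht).measurable.ennreal_ofReal

theorem cost_le (h : CCFactorization θ φ ψ) {s t a b c : ℝ} (hs : 0 < s) (ht : 0 < t)
    (ha : 0 ≤ a) (hb : 0 ≤ b) (hc : 0 ≤ c) (hcab : c ≤ a + b) :
    φ (ψ c / (s + t)) ≤ s / (s + t) * φ (ψ a / s) + t / (s + t) * φ (ψ b / t) := by
  have hst : 0 < s + t := add_pos hs ht
  have hψ : ψ c ≤ ψ a + ψ b :=
    (h.psi_strictMono.monotoneOn hc (add_nonneg ha hb) hcab).trans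
      (h.psi_concave.add_le_of_nonneg h.psi_zero.ge ha hb)
  have ha' := h.psi_mapsTo ha
  have hb' := h.psi_mapsTo hb
  calc φ (ψ c / (s + t)) ≤ φ ((ψ a + ψ b) / (s + t)) :=
        h.phi_strictMono.monotoneOn (div_nonneg (h.psi_mapsTo hc) hst.le)
          (div_nonneg (add_nonneg ha' hb') hst.le) (by gcongr)
    _ = φ (s / (s + t) * (ψ a / s) + t / (s + t) * (ψ b / t)) := by
        congr 1
        field_simp
    _ ≤ _ := h.phi_convex.2 (div_nonneg ha' hs.le) (div_nonneg hb' ht.le)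
        (div_nonneg hs.le hst.le) (div_nonneg ht.le hst.le) (by field_simp)

/-- Gluing two couplings whose costs at scales `s` and `t` are at most `C` gives a coupling whose
cost at scale `s + t` is at most `C`. -/
theorem exists_coupling_lintegral_le (h : CCFactorization θ φ ψ) {X : Type*} [MetricSpace X]
    [SecondCountableTopology X] [MeasurableSpace X] [BorelSpace X] [StandardBorelSpace X]
    [Nonempty X] {μ₁ μ₂ μ₃ : Measure X} {q r : Measure (X × X)}
    (hq : q ∈ Couplings μ₁ μ₂) (hr : r ∈ Couplings μ₂ μ₃) {s t : ℝ} (hs : 0 < s) (ht : 0 < t)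
    {C : ℝ≥0∞} (hqC : ∫⁻ p, ENNReal.ofReal (φ (ψ (dist p.1 p.2) / s)) ∂q ≤ C)
    (hrC : ∫⁻ p, ENNReal.ofReal (φ (ψ (dist p.1 p.2) / t)) ∂r ≤ C) :
    ∃ w ∈ Couplings μ₁ μ₃,
      ∫⁻ p, ENNReal.ofReal (φ (ψ (dist p.1 p.2) / (s + t))) ∂w ≤ C := by
  obtain ⟨m, rfl, rfl⟩ := exists_gluing hq hr
  obtain ⟨hmp, hμ₁, -⟩ := hq
  obtain ⟨-, -, hμ₃⟩ := hr
  have hm : IsProbabilityMeasure m :=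
    (Measure.isProbabilityMeasure_map_iff (by fun_prop)).1 hmp
  have hst : 0 < s + t := add_pos hs ht
  rw [Measure.map_map (by fun_prop) (by fun_prop)] at hμ₁ hμ₃
  rw [lintegral_map (h.measurable_cost hs.le) (by fun_prop)] at hqC
  rw [lintegral_map (h.measurable_cost ht.le) (by fun_prop)] at hrC
  refine ⟨m.map Prod.snd, ⟨Measure.isProbabilityMeasure_map (by fun_prop), ?_, ?_⟩, ?_⟩
  · rwa [Measure.map_map (by fun_prop) (by fun_prop)]
  · rwa [Measure.map_map (by fun_prop) (by fun_prop)]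
  rw [lintegral_map (h.measurable_cost hst.le) (by fun_prop)]
  have hpt : ∀ p : X × X × X, ENNReal.ofReal (φ (ψ (dist p.2.1 p.2.2) / (s + t))) ≤
      ENNReal.ofReal (s / (s + t)) * ENNReal.ofReal (φ (ψ (dist p.2.1 p.1) / s)) +
        ENNReal.ofReal (t / (s + t)) * ENNReal.ofReal (φ (ψ (dist p.1 p.2.2) / t)) := by
    intro p
    rw [← ENNReal.ofReal_mul (by positivity), ← ENNReal.ofReal_mul (by positivity),
      ← ENNReal.ofReal_add
        (mul_nonneg (by positivity) (h.cost_nonneg hs.le dist_nonneg))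
        (mul_nonneg (by positivity) (h.cost_nonneg ht.le dist_nonneg))]
    exact ENNReal.ofReal_le_ofReal
      (h.cost_le hs ht dist_nonneg dist_nonneg dist_nonneg (dist_triangle _ _ _))
  have hms : Measurable fun p : X × X × X => ENNReal.ofReal (φ (ψ (dist p.2.1 p.1) / s)) :=
    (h.measurable_cost hs.le).comp (by fun_prop : Measurable fun p : X × X × X => (p.2.1, p.1))
  calc _ ≤ _ := lintegral_mono hpt
    _ = ENNReal.ofReal (s / (s + t)) * _ + ENNReal.ofReal (t / (s + t)) * _ := by
        rw [lintegral_add_left (hms.const_mul _), lintegral_const_mul' _ _ ENNReal.ofReal_ne_top,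
          lintegral_const_mul' _ _ ENNReal.ofReal_ne_top]
    _ ≤ ENNReal.ofReal (s / (s + t)) * C + ENNReal.ofReal (t / (s + t)) * C := by gcongr
    _ = C := by
        rw [← add_mul, ← ENNReal.ofReal_add (by positivity) (by positivity), ← add_div,
          div_self hst.ne', ENNReal.ofReal_one, one_mul]

end CCFactorization

/-- The triangle inequality for `W_θ` on the whole space of Borel probability measures. -/
theorem WTheta_triangle
    {X : Type*} [MetricSpace X] [CompleteSpace X] [TopologicalSpace.SeparableSpace X]
    [MeasurableSpace X] [BorelSpace X]
    (θ φ ψ : ℝ → ℝ) (hfact : CCFactorization θ φ ψ)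
    (μ₁ μ₂ μ₃ : Measure X)
    [IsProbabilityMeasure μ₁] [IsProbabilityMeasure μ₂] [IsProbabilityMeasure μ₃] :
    WTheta φ ψ μ₁ μ₃ ≤ WTheta φ ψ μ₁ μ₂ + WTheta φ ψ μ₂ μ₃ := by
  have hne : Nonempty X := nonempty_of_isProbabilityMeasure μ₁
  have hsc : SecondCountableTopology X := UniformSpace.secondCountable_of_separable X
  have hpol : PolishSpace X := inferInstance
  have hbs : StandardBorelSpace X := inferInstance
  unfold WTheta
  rw [sInf_eq_iInf (s := {t | _ ∧ _ ∧ (⨅ q ∈ Couplings μ₁ μ₂, _) ≤ _}),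
    sInf_eq_iInf (s := {t | _ ∧ _ ∧ (⨅ q ∈ Couplings μ₂ μ₃, _) ≤ _})]
  refine ENNReal.le_iInf₂_add_iInf₂ ?_
  rintro s ⟨hs, hs', hsq⟩ t ⟨ht, ht', htr⟩
  refine sInf_le ⟨add_pos_of_pos_of_nonneg hs zero_le, ENNReal.add_ne_top.2 ⟨hs', ht'⟩, ?_⟩
  refine le_of_forall_gt_imp_ge_of_dense fun C hC => ?_
  obtain ⟨q, hq, hqC⟩ := by simpa only [iInf_lt_iff, exists_prop] using hsq.trans_lt hC
  obtain ⟨r, hr, hrC⟩ := by simpa only [iInf_lt_iff, exists_prop] using htr.trans_lt hC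
  obtain ⟨w, hw, hwC⟩ := hfact.exists_coupling_lintegral_le hq hr
    (ENNReal.toReal_pos hs.ne' hs') (ENNReal.toReal_pos ht.ne' ht') hqC.le hrC.le
  rw [ENNReal.toReal_add hs' ht']
  exact (iInf₂_le w hw).trans hwC
end

section
/- Let (X, d) be a complete separable metric space and (φ, ψ) a convex-concave factorization of a ccc function θ. Then (P_θ(X), W_θ) is complete: for every sequence (μ_k) in P_θ(X) which is Cauchy with respect to W_θ, there exists μ ∈ P_θ(X) with W_θ(μ_k, μ) → 0 as k → ∞. -/
open Set Function MeasureTheory Filter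
open scoped ENNReal Topology

/-- The integrand `φ(ψ(d(x,y))/t)` in the definition of `WTheta`. -/
noncomputable def wCost {X : Type*} [MetricSpace X] (φ ψ : ℝ → ℝ) (t : ℝ) (x y : X) : ℝ≥0∞ :=
  ENNReal.ofReal (φ (ψ (dist x y) / t))

namespace CCFactorization

variable {θ φ ψ : ℝ → ℝ}

lemma psi_nonneg (h : CCFactorization θ φ ψ) {a : ℝ} (ha : 0 ≤ a) : 0 ≤ ψ a := h.psi_mapsTo ha

lemma phi_nonneg (h : CCFactorization θ φ ψ) {a : ℝ} (ha : 0 ≤ a) : 0 ≤ φ a := h.phi_mapsTo ha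

lemma psi_add_le (h : CCFactorization θ φ ψ) {a b : ℝ} (ha : 0 ≤ a) (hb : 0 ≤ b) :
    ψ (a + b) ≤ ψ a + ψ b := by
  rcases (add_nonneg ha hb).eq_or_lt with h0 | h0
  · have : a = 0 := by linarith
    have : b = 0 := by linarith
    subst_vars
    simp [h.psi_zero]
  · have scale : ∀ c d : ℝ, 0 ≤ c → 0 ≤ d → c + d = a + b →
        c / (a + b) * ψ (a + b) ≤ ψ c := by
      intro c d hc hd hcd
      have := h.psi_concave.2 (mem_Ici.2 h0.le) (mem_Ici.2 le_rfl)
        (div_nonneg hc h0.le) (div_nonneg hd h0.le) (by rw [← add_div, hcd, div_self h0.ne'])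
      simpa [h.psi_zero, h0.ne'] using this
    have h1 := scale a b ha hb rfl
    have h2 := scale b a hb ha (add_comm _ _)
    calc ψ (a + b) = a / (a + b) * ψ (a + b) + b / (a + b) * ψ (a + b) := by
          rw [← add_mul, ← add_div, div_self h0.ne', one_mul]
      _ ≤ ψ a + ψ b := add_le_add h1 h2

variable {X : Type*} [MetricSpace X]

lemma psi_dist_nonneg (h : CCFactorization θ φ ψ) (x y : X) : 0 ≤ ψ (dist x y) :=
  h.psi_nonneg dist_nonneg

lemma psi_dist_triangle (h : CCFactorization θ φ ψ) (x y z : X) :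
    ψ (dist x z) ≤ ψ (dist x y) + ψ (dist y z) :=
  (h.psi_strictMono.monotoneOn (mem_Ici.2 dist_nonneg)
    (mem_Ici.2 (add_nonneg dist_nonneg dist_nonneg)) (dist_triangle x y z)).trans
    (h.psi_add_le dist_nonneg dist_nonneg)

lemma continuous_wCost (h : CCFactorization θ φ ψ) {s : ℝ} (hs : 0 ≤ s) :
    Continuous fun p : X × X ↦ wCost φ ψ s p.1 p.2 := by
  refine ENNReal.continuous_ofReal.comp (h.phi_continuous.comp_continuous
    ((h.psi_continuous.comp_continuous continuous_dist fun p ↦ dist_nonneg).div_const s) ?_)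
  exact fun p ↦ div_nonneg (h.psi_dist_nonneg _ _) hs

lemma wCost_anti (h : CCFactorization θ φ ψ) {s t : ℝ} (hs : 0 < s) (hst : s ≤ t) (x y : X) :
    wCost φ ψ t x y ≤ wCost φ ψ s x y := by
  have h0 := h.psi_dist_nonneg x y
  exact ENNReal.ofReal_le_ofReal <| h.phi_strictMono.monotoneOn
    (mem_Ici.2 (div_nonneg h0 (hs.trans_le hst).le)) (mem_Ici.2 (div_nonneg h0 hs.le)) (by gcongr)

lemma wCost_self (h : CCFactorization θ φ ψ) (s : ℝ) (x : X) : wCost φ ψ s x x = 0 := by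
  simp [wCost, h.psi_zero, h.phi_zero]

lemma wCost_triangle (h : CCFactorization θ φ ψ) {s : ℝ} (hs : 0 < s) (x y z : X) :
    wCost φ ψ (2 * s) x z ≤ 2⁻¹ * wCost φ ψ s x y + 2⁻¹ * wCost φ ψ s y z := by
  have hxy := div_nonneg (h.psi_dist_nonneg x y) hs.le
  have hyz := div_nonneg (h.psi_dist_nonneg y z) hs.le
  have hle : φ (ψ (dist x z) / (2 * s)) ≤
      2⁻¹ * φ (ψ (dist x y) / s) + 2⁻¹ * φ (ψ (dist y z) / s) := by
    refine le_trans (h.phi_strictMono.monotoneOn (b := 2⁻¹ * (ψ (dist x y) / s) +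
      2⁻¹ * (ψ (dist y z) / s)) (mem_Ici.2 ?_) (mem_Ici.2 (by positivity)) ?_) ?_
    · exact div_nonneg (h.psi_dist_nonneg x z) (by positivity)
    · calc ψ (dist x z) / (2 * s) ≤ (ψ (dist x y) + ψ (dist y z)) / (2 * s) := by
            gcongr; exact h.psi_dist_triangle x y z
        _ = _ := by field_simp
    · exact h.phi_convex.2 (mem_Ici.2 hxy) (mem_Ici.2 hyz) (by norm_num) (by norm_num)
        (by norm_num)
  have h2 : (2⁻¹ : ℝ≥0∞) = ENNReal.ofReal 2⁻¹ := by
    rw [ENNReal.ofReal_inv_of_pos two_pos]; simp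
  have n1 := h.phi_nonneg hxy
  have n2 := h.phi_nonneg hyz
  rw [wCost, wCost, wCost, h2, ← ENNReal.ofReal_mul (by norm_num),
    ← ENNReal.ofReal_mul (by norm_num), ← ENNReal.ofReal_add (by positivity) (by positivity)]
  exact ENNReal.ofReal_le_ofReal hle

lemma wCost_two_mul_le (h : CCFactorization θ φ ψ) {s : ℝ} (hs : 0 < s) (x y : X) :
    wCost φ ψ (2 * s) x y ≤ 2⁻¹ * wCost φ ψ s x y := by
  simpa [h.wCost_self] using h.wCost_triangle hs x y y

lemma phi_one_pos (h : CCFactorization θ φ ψ) : 0 < φ 1 := by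
  simpa [h.phi_zero] using h.phi_strictMono (mem_Ici.2 le_rfl) (mem_Ici.2 zero_le_one) one_pos

lemma phi_one_mul_le (h : CCFactorization θ φ ψ) {u : ℝ} (hu : 0 ≤ u) : φ 1 * u ≤ φ 1 + φ u := by
  have h1 := h.phi_one_pos
  have h2 := h.phi_nonneg hu
  rcases le_total u 1 with hu1 | hu1
  · nlinarith
  · have hu0 : 0 < u := by linarith
    have := h.phi_convex.2 (mem_Ici.2 hu) (mem_Ici.2 (le_refl (0 : ℝ)))
      (inv_nonneg.2 hu) (sub_nonneg.2 (inv_le_one_of_one_le₀ hu1)) (by ring)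
    simp only [smul_eq_mul, h.phi_zero, mul_zero, add_zero, inv_mul_cancel₀ hu0.ne'] at this
    have := mul_le_mul_of_nonneg_left this hu
    rw [← mul_assoc, mul_inv_cancel₀ hu0.ne', one_mul] at this
    linarith

lemma psi_dist_le_wCost (h : CCFactorization θ φ ψ) {s : ℝ} (hs : 0 < s) (x y : X) :
    ENNReal.ofReal (φ 1) * ENNReal.ofReal (ψ (dist x y)) ≤
      ENNReal.ofReal s * (ENNReal.ofReal (φ 1) + wCost φ ψ s x y) := by
  have h1 := h.phi_one_pos
  have hu := div_nonneg (h.psi_dist_nonneg x y) hs.le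
  have h2 := h.phi_nonneg hu
  rw [wCost, ← ENNReal.ofReal_add h1.le h2, ← ENNReal.ofReal_mul h1.le,
    ← ENNReal.ofReal_mul hs.le]
  refine ENNReal.ofReal_le_ofReal ?_
  have := mul_le_mul_of_nonneg_left (h.phi_one_mul_le hu) hs.le
  calc φ 1 * ψ (dist x y) = s * (φ 1 * (ψ (dist x y) / s)) := by field_simp
    _ ≤ _ := this

lemma wCost_le_tsum (h : CCFactorization θ φ ψ) (x : ℕ → X) (j n : ℕ) :
    wCost φ ψ (2 * 2⁻¹ ^ n) (x n) (x (n + j)) ≤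
      ∑' i, 2⁻¹ ^ (i + 1) * wCost φ ψ (2⁻¹ ^ (n + i)) (x (n + i)) (x (n + i + 1)) := by
  induction j generalizing n with
  | zero => simp [h.wCost_self]
  | succ j ih =>
    rw [tsum_eq_zero_add' ENNReal.summable]
    refine (h.wCost_triangle (by positivity) (x n) (x (n + 1)) (x (n + (j + 1)))).trans ?_
    refine add_le_add (by simp) ?_
    have e : (2⁻¹ : ℝ) ^ n = 2 * 2⁻¹ ^ (n + 1) := by rw [pow_succ]; ring
    rw [e, ← add_assoc, add_right_comm]
    refine (mul_le_mul_right (ih (n + 1)) _).trans_eq ?_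
    rw [← ENNReal.tsum_mul_left]
    refine tsum_congr fun i ↦ ?_
    rw [← mul_assoc, ← pow_succ', show n + 1 + i = n + (i + 1) by ring]

lemma psi_dist_le_sum (h : CCFactorization θ φ ψ) (x : ℕ → X) {m n : ℕ} (hmn : m ≤ n) :
    ψ (dist (x m) (x n)) ≤ ∑ i ∈ Finset.range n, ψ (dist (x i) (x (i + 1))) -
      ∑ i ∈ Finset.range m, ψ (dist (x i) (x (i + 1))) := by
  induction n, hmn using Nat.le_induction with
  | base => simp [h.psi_zero]
  | succ n hmn ih =>
    rw [Finset.sum_range_succ]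
    linarith [h.psi_dist_triangle (x m) (x n) (x (n + 1))]

lemma cauchySeq_of_tsum_ne_top (h : CCFactorization θ φ ψ) (x : ℕ → X)
    (hx : ∑' i, ENNReal.ofReal (ψ (dist (x i) (x (i + 1)))) ≠ ∞) : CauchySeq x := by
  have hs : Summable fun i ↦ ψ (dist (x i) (x (i + 1))) := by
    simpa [ENNReal.toReal_ofReal, h.psi_dist_nonneg] using ENNReal.summable_toReal hx
  have hc := hs.hasSum.tendsto_sum_nat.cauchySeq
  refine Metric.cauchySeq_iff'.2 fun ε hε ↦ ?_
  have hψ : 0 < ψ ε := by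
    simpa [h.psi_zero] using h.psi_strictMono (mem_Ici.2 le_rfl) (mem_Ici.2 hε.le) hε
  obtain ⟨N, hN⟩ := Metric.cauchySeq_iff'.1 hc (ψ ε) hψ
  refine ⟨N, fun n hn ↦ ?_⟩
  have := (h.psi_dist_le_sum x hn).trans_lt ((le_abs_self _).trans_lt (hN n hn))
  rw [dist_comm]
  exact (h.psi_strictMono.lt_iff_lt (mem_Ici.2 dist_nonneg) (mem_Ici.2 hε.le)).1 this

lemma cauchySeq_of_tsum_wCost_ne_top (h : CCFactorization θ φ ψ) (x : ℕ → X)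
    (hx : ∑' i, 2⁻¹ ^ (i + 1) * wCost φ ψ (2⁻¹ ^ i) (x i) (x (i + 1)) ≠ ∞) : CauchySeq x := by
  refine h.cauchySeq_of_tsum_ne_top x fun htop ↦ ?_
  have h1 : ENNReal.ofReal (φ 1) ≠ 0 := by simpa using h.phi_one_pos
  have h2 : ∀ i : ℕ, ENNReal.ofReal (2⁻¹ ^ i) = 2 * 2⁻¹ ^ (i + 1) := fun i ↦ by
    rw [pow_succ', ← mul_assoc, ENNReal.mul_inv_cancel (by simp) (by simp), one_mul,
      ENNReal.ofReal_pow (by norm_num), ENNReal.ofReal_inv_of_pos two_pos]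
    simp
  have hle : ENNReal.ofReal (φ 1) * ∑' i, ENNReal.ofReal (ψ (dist (x i) (x (i + 1)))) ≤
      2 * ((∑' i : ℕ, 2⁻¹ ^ (i + 1)) * ENNReal.ofReal (φ 1) +
        ∑' i, 2⁻¹ ^ (i + 1) * wCost φ ψ (2⁻¹ ^ i) (x i) (x (i + 1))) := by
    rw [← ENNReal.tsum_mul_left, ← ENNReal.tsum_mul_right, ← ENNReal.tsum_add,
      ← ENNReal.tsum_mul_left]
    refine ENNReal.tsum_le_tsum fun i ↦ ?_
    refine (h.psi_dist_le_wCost (s := 2⁻¹ ^ i) (by positivity) _ _).trans_eq ?_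
    rw [h2]
    ring
  rw [htop, ENNReal.mul_top h1, top_le_iff] at hle
  refine ENNReal.mul_ne_top (by simp) (ENNReal.add_ne_top.2 ⟨ENNReal.mul_ne_top ?_ (by simp), hx⟩)
    hle
  rw [ENNReal.tsum_geometric_add_one, ENNReal.one_sub_inv_two, inv_inv,
    ENNReal.inv_mul_cancel (by simp) (by simp)]
  simp

end CCFactorization

open ProbabilityTheory in
/-- Gluing along an infinite chain of couplings. -/
lemma exists_measure_of_couplings {X : Type*} [MeasurableSpace X] [StandardBorelSpace X]
    [Nonempty X] {ν : ℕ → Measure X} {q : ℕ → Measure (X × X)}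
    (hq : ∀ n, q n ∈ Couplings (ν n) (ν (n + 1))) :
    ∃ P : Measure (ℕ → X), IsProbabilityMeasure P ∧
      ∀ n, P.map (fun x ↦ (x n, x (n + 1))) = q n := by
  have hqp : ∀ n, IsProbabilityMeasure (q n) := fun n ↦ (hq n).1
  have hν0 : IsProbabilityMeasure (ν 0) := by
    rw [← (hq 0).2.1]; exact Measure.isProbabilityMeasure_map (by fun_prop)
  let last (n : ℕ) : (Finset.Iic n → X) → X := fun z ↦ z ⟨n, Finset.mem_Iic.2 le_rfl⟩
  have hlast (n : ℕ) : Measurable (last n) := measurable_pi_apply _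
  let κ (n : ℕ) : Kernel (Finset.Iic n → X) X := (q n).condKernel.comap (last n) (hlast n)
  let P : Measure (ℕ → X) := Kernel.trajMeasure (X := fun _ ↦ X) (ν 0) κ
  have hP : IsProbabilityMeasure P := by
    unfold P; infer_instance
  have step (n : ℕ) : P.map (fun x ↦ (x n, x (n + 1))) =
      (P.map fun x ↦ x n) ⊗ₘ (q n).condKernel := by
    have key : P.map (Preorder.frestrictLe n) ⊗ₘ κ n =
        P.map (fun x ↦ (Preorder.frestrictLe n x, x (n + 1))) :=
      Kernel.map_frestrictLe_trajMeasure_compProd_eq_map_trajMeasure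
    have e : (fun x : ℕ → X ↦ (x n, x (n + 1))) =
        Prod.map (last n) id ∘ fun x ↦ (Preorder.frestrictLe n x, x (n + 1)) := rfl
    have e' : (fun x : ℕ → X ↦ x n) = last n ∘ Preorder.frestrictLe n := rfl
    have : IsProbabilityMeasure (P.map (Preorder.frestrictLe (π := fun _ ↦ X) n)) :=
      Measure.isProbabilityMeasure_map (by fun_prop)
    have : IsProbabilityMeasure (P.map fun x ↦ x n) :=
      Measure.isProbabilityMeasure_map (measurable_pi_apply n).aemeasurable
    rw [e, ← Measure.map_map (by fun_prop) (by fun_prop), ← key]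
    ext s hs
    rw [Measure.map_apply (by fun_prop) hs, Measure.compProd_apply hs,
      Measure.compProd_apply (hs.preimage (by fun_prop)), e',
      ← Measure.map_map (hlast n) (by fun_prop),
      lintegral_map (Kernel.measurable_kernel_prodMk_left hs) (hlast n)]
    rfl
  have marg (n : ℕ) : (P.map fun x ↦ x n) = ν n := by
    induction n with
    | zero =>
      have e : (fun x : ℕ → X ↦ x 0) = last 0 ∘ Preorder.frestrictLe 0 := rfl
      unfold P Kernel.trajMeasure
      rw [e, ← Measure.map_map (hlast 0) (by fun_prop),
        Measure.map_comp _ _ (by fun_prop), Kernel.traj_map_frestrictLe, Kernel.partialTraj_self,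
        Measure.id_comp, Measure.map_map (hlast 0) (by fun_prop)]
      exact Measure.map_id
    | succ n ih =>
      have hs := step n
      rw [ih, ← (hq n).2.1] at hs
      have := (q n).disintegrate (q n).condKernel
      rw [Measure.fst] at this
      rw [this] at hs
      rw [← (hq n).2.2, ← hs, Measure.map_map (by fun_prop) (by fun_prop)]
      rfl
  refine ⟨P, hP, fun n ↦ ?_⟩
  rw [step n, marg n, ← (hq n).2.1]
  exact (q n).disintegrate (q n).condKernel

lemma mem_couplings_map {Ω X : Type*} [MeasurableSpace Ω] [MeasurableSpace X]
    {P : Measure Ω} [IsProbabilityMeasure P]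
    {f g : Ω → X} (hf : Measurable f) (hg : Measurable g) :
    P.map (fun ω ↦ (f ω, g ω)) ∈ Couplings (P.map f) (P.map g) := by
  refine ⟨Measure.isProbabilityMeasure_map (by fun_prop), ?_, ?_⟩ <;>
  · rw [Measure.map_map (by fun_prop) (by fun_prop)]; rfl

lemma isProbabilityMeasure_of_mem_couplings {X : Type*} [MeasurableSpace X] {μ ν : Measure X}
    {q : Measure (X × X)} (hq : q ∈ Couplings μ ν) : IsProbabilityMeasure μ ∧ IsProbabilityMeasure ν := by
  have := hq.1
  rw [← hq.2.1, ← hq.2.2]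
  exact ⟨Measure.isProbabilityMeasure_map (by fun_prop),
    Measure.isProbabilityMeasure_map (by fun_prop)⟩

section WTheta

variable {X : Type*} [MetricSpace X] [MeasurableSpace X] {θ φ ψ : ℝ → ℝ}

lemma WTheta_le_of_coupling {μ ν : Measure X} {q : Measure (X × X)} (hq : q ∈ Couplings μ ν)
    {r : ℝ} (hr : 0 < r) (hle : ∫⁻ p, wCost φ ψ r p.1 p.2 ∂q ≤ 1) :
    WTheta φ ψ μ ν ≤ ENNReal.ofReal r := by
  refine sInf_le ⟨by simpa using hr, ENNReal.ofReal_ne_top, ?_⟩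
  rw [ENNReal.toReal_ofReal hr.le]
  exact (iInf₂_le q hq).trans hle

variable [BorelSpace X] [SecondCountableTopology X]

lemma CCFactorization.measurable_wCost (h : CCFactorization θ φ ψ) {s : ℝ} (hs : 0 ≤ s) :
    Measurable fun p : X × X ↦ wCost φ ψ s p.1 p.2 :=
  (h.continuous_wCost hs).measurable

lemma exists_coupling_of_WTheta_lt (h : CCFactorization θ φ ψ) {μ ν : Measure X} {r : ℝ}
    (hlt : WTheta φ ψ μ ν < ENNReal.ofReal r) :
    ∃ q ∈ Couplings μ ν, ∫⁻ p, wCost φ ψ (2 * r) p.1 p.2 ∂q ≤ 1 := by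
  obtain ⟨t, ⟨ht0, ht, hinf⟩, htr⟩ := sInf_lt_iff.1 hlt
  obtain ⟨q, hq, hq2⟩ : ∃ q ∈ Couplings μ ν, ∫⁻ p, wCost φ ψ t.toReal p.1 p.2 ∂q < 2 := by
    simpa only [wCost, iInf_lt_iff, exists_prop] using hinf.trans_lt ENNReal.one_lt_two
  have ht' : 0 < t.toReal := ENNReal.toReal_pos ht0.ne' ht
  have htr' : t.toReal ≤ r := by
    have hr : 0 < r := ENNReal.ofReal_pos.1 (ht0.trans htr)
    exact ENNReal.toReal_le_of_le_ofReal hr.le htr.le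
  refine ⟨q, hq, ?_⟩
  calc ∫⁻ p, wCost φ ψ (2 * r) p.1 p.2 ∂q
      ≤ ∫⁻ p, 2⁻¹ * wCost φ ψ t.toReal p.1 p.2 ∂q := lintegral_mono fun p ↦
        (h.wCost_anti (by positivity) (by linarith) _ _).trans (h.wCost_two_mul_le ht' _ _)
    _ = 2⁻¹ * ∫⁻ p, wCost φ ψ t.toReal p.1 p.2 ∂q :=
        lintegral_const_mul _ (h.measurable_wCost ht'.le)
    _ ≤ 2⁻¹ * 2 := by gcongr
    _ = 1 := ENNReal.inv_mul_cancel (by simp) (by simp)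

lemma MemPTheta.of_coupling (h : CCFactorization θ φ ψ) {μ ν : Measure X}
    (hμ : MemPTheta φ ψ μ) {q : Measure (X × X)} (hq : q ∈ Couplings μ ν) {r : ℝ} (hr : 0 < r)
    (hle : ∫⁻ p, wCost φ ψ r p.1 p.2 ∂q ≤ 1) : MemPTheta φ ψ ν := by
  have := hq.1
  obtain ⟨-, y, t, ht, hint⟩ := hμ
  refine ⟨hq.2.2 ▸ Measure.isProbabilityMeasure_map (by fun_prop), y, 2 * max r t,
    by positivity, ?_⟩
  have hs : 0 < max r t := by positivity
  have hmy : ∀ s : ℝ, 0 ≤ s → Measurable fun x : X ↦ wCost φ ψ s x y := fun s hs ↦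
    (h.measurable_wCost hs).comp (g := fun p : X × X ↦ wCost φ ψ s p.1 p.2)
      (f := fun x ↦ (x, y)) (by fun_prop)
  change ∫⁻ x, wCost φ ψ (2 * max r t) x y ∂ν < ∞
  change ∫⁻ x, wCost φ ψ t x y ∂μ < ∞ at hint
  rw [← hq.2.1, lintegral_map (hmy t ht.le) (by fun_prop)] at hint
  rw [← hq.2.2, lintegral_map (hmy _ (by positivity)) (by fun_prop)]
  calc ∫⁻ p, wCost φ ψ (2 * max r t) p.2 y ∂q
      ≤ ∫⁻ p, (wCost φ ψ r p.1 p.2 + wCost φ ψ t p.1 y) ∂q := by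
        refine lintegral_mono fun p ↦ (h.wCost_triangle hs p.2 p.1 y).trans ?_
        have half : ∀ a : ℝ≥0∞, 2⁻¹ * a ≤ a := fun a ↦ mul_le_of_le_one_left' (by simp)
        refine add_le_add ((half _).trans ?_) ((half _).trans ?_)
        · have : wCost φ ψ (max r t) p.2 p.1 = wCost φ ψ (max r t) p.1 p.2 := by
            rw [wCost, wCost, dist_comm]
          rw [this]
          exact h.wCost_anti hr (le_max_left _ _) _ _
        · exact h.wCost_anti ht (le_max_right _ _) _ _
    _ = ∫⁻ p, wCost φ ψ r p.1 p.2 ∂q + ∫⁻ p, wCost φ ψ t p.1 y ∂q :=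
        lintegral_add_left (h.measurable_wCost hr.le) _
    _ < ∞ := ENNReal.add_lt_top.2 ⟨hle.trans_lt ENNReal.one_lt_top, hint⟩

variable [CompleteSpace X]

lemma exists_coupling_trans (h : CCFactorization θ φ ψ) {μ ν ρ : Measure X}
    {q q' : Measure (X × X)} (hq : q ∈ Couplings μ ν) (hq' : q' ∈ Couplings ν ρ) {r : ℝ}
    (hr : 0 < r) (hle : ∫⁻ p, wCost φ ψ r p.1 p.2 ∂q ≤ 1)
    (hle' : ∫⁻ p, wCost φ ψ r p.1 p.2 ∂q' ≤ 1) :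
    ∃ p ∈ Couplings μ ρ, ∫⁻ x, wCost φ ψ (2 * r) x.1 x.2 ∂p ≤ 1 := by
  obtain ⟨hμ, -⟩ := isProbabilityMeasure_of_mem_couplings hq
  obtain ⟨-, hρ⟩ := isProbabilityMeasure_of_mem_couplings hq'
  have : Nonempty X := nonempty_of_isProbabilityMeasure μ
  have hdiag : ρ.map (fun x ↦ (x, x)) ∈ Couplings ρ ρ := by
    simpa using mem_couplings_map (P := ρ) measurable_id measurable_id
  let c : ℕ → Measure X := fun n ↦ match n with
    | 0 => μ
    | 1 => ν
    | _ + 2 => ρ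
  let Q : ℕ → Measure (X × X) := fun n ↦ match n with
    | 0 => q
    | 1 => q'
    | _ + 2 => ρ.map (fun x ↦ (x, x))
  obtain ⟨P, hP, hPQ⟩ := exists_measure_of_couplings (ν := c) (q := Q) fun n ↦
    match n with
    | 0 => hq
    | 1 => hq'
    | _ + 2 => hdiag
  have h0 : P.map (fun x ↦ (x 0, x 1)) = q := hPQ 0
  have h1 : P.map (fun x ↦ (x 1, x 2)) = q' := hPQ 1
  have e0 : P.map (fun x ↦ x 0) = μ := by
    rw [← hq.2.1, ← h0, Measure.map_map (by fun_prop) (by fun_prop)]; rfl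
  have e2 : P.map (fun x ↦ x 2) = ρ := by
    rw [← hq'.2.2, ← h1, Measure.map_map (by fun_prop) (by fun_prop)]; rfl
  refine ⟨P.map fun x ↦ (x 0, x 2), ?_, ?_⟩
  · rw [← e0, ← e2]
    exact mem_couplings_map (measurable_pi_apply _) (measurable_pi_apply _)
  have hm := h.measurable_wCost (X := X) hr.le
  rw [← h0, lintegral_map hm (by fun_prop)] at hle
  rw [← h1, lintegral_map hm (by fun_prop)] at hle'
  rw [lintegral_map (h.measurable_wCost (by positivity)) (by fun_prop)]
  have hm0 : Measurable fun x : ℕ → X ↦ wCost φ ψ r (x 0) (x 1) :=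
    hm.comp (g := fun p : X × X ↦ wCost φ ψ r p.1 p.2) (f := fun x : ℕ → X ↦ (x 0, x 1))
      (by fun_prop)
  have hm1 : Measurable fun x : ℕ → X ↦ wCost φ ψ r (x 1) (x 2) :=
    hm.comp (g := fun p : X × X ↦ wCost φ ψ r p.1 p.2) (f := fun x : ℕ → X ↦ (x 1, x 2))
      (by fun_prop)
  calc ∫⁻ x, wCost φ ψ (2 * r) (x 0) (x 2) ∂P
      ≤ ∫⁻ x, (2⁻¹ * wCost φ ψ r (x 0) (x 1) + 2⁻¹ * wCost φ ψ r (x 1) (x 2)) ∂P :=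
        lintegral_mono fun x ↦ h.wCost_triangle hr _ _ _
    _ = 2⁻¹ * ∫⁻ x, wCost φ ψ r (x 0) (x 1) ∂P + 2⁻¹ * ∫⁻ x, wCost φ ψ r (x 1) (x 2) ∂P := by
        rw [lintegral_add_left (hm0.const_mul _), lintegral_const_mul _ hm0,
          lintegral_const_mul _ hm1]
    _ ≤ 2⁻¹ * 1 + 2⁻¹ * 1 := by gcongr
    _ = 1 := by simp [ENNReal.inv_two_add_inv_two]

lemma exists_limit_of_chain (h : CCFactorization θ φ ψ) {ν : ℕ → Measure X}
    {q : ℕ → Measure (X × X)} (hq : ∀ n, q n ∈ Couplings (ν n) (ν (n + 1)))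
    (hle : ∀ n, ∫⁻ p, wCost φ ψ (2⁻¹ ^ n) p.1 p.2 ∂(q n) ≤ 1) :
    ∃ μ : Measure X, ∀ n, ∃ p ∈ Couplings (ν n) μ,
      ∫⁻ x, wCost φ ψ (2 * 2⁻¹ ^ n) x.1 x.2 ∂p ≤ 1 := by
  obtain ⟨hν, -⟩ := isProbabilityMeasure_of_mem_couplings (hq 0)
  have : Nonempty X := nonempty_of_isProbabilityMeasure (ν 0)
  obtain ⟨P, hP, hPq⟩ := exists_measure_of_couplings hq
  have hmeas : ∀ (r : ℝ), 0 ≤ r → ∀ n : ℕ,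
      Measurable fun x : ℕ → X ↦ wCost φ ψ r (x n) (x (n + 1)) := fun r hr n ↦
    (h.measurable_wCost hr).comp (g := fun p : X × X ↦ wCost φ ψ r p.1 p.2)
      (f := fun x : ℕ → X ↦ (x n, x (n + 1))) (by fun_prop)
  let G (n : ℕ) (x : ℕ → X) : ℝ≥0∞ :=
    ∑' i, 2⁻¹ ^ (i + 1) * wCost φ ψ (2⁻¹ ^ (n + i)) (x (n + i)) (x (n + i + 1))
  have hG (n : ℕ) : Measurable (G n) :=
    Measurable.tsum fun i ↦ (hmeas _ (by positivity) _).const_mul _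
  have hGint (n : ℕ) : ∫⁻ x, G n x ∂P ≤ 1 := by
    rw [lintegral_tsum fun i ↦ ((hmeas _ (by positivity) _).const_mul _).aemeasurable]
    calc ∑' i, ∫⁻ x, 2⁻¹ ^ (i + 1) * wCost φ ψ (2⁻¹ ^ (n + i)) (x (n + i)) (x (n + i + 1)) ∂P
        ≤ ∑' i : ℕ, 2⁻¹ ^ (i + 1) := by
          refine ENNReal.tsum_le_tsum fun i ↦ ?_
          rw [lintegral_const_mul _ (hmeas _ (by positivity) _)]
          refine mul_le_of_le_one_right' ?_
          have := hle (n + i)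
          rwa [← hPq, lintegral_map (h.measurable_wCost (by positivity)) (by fun_prop)] at this
      _ = 1 := by
          rw [ENNReal.tsum_geometric_add_one, ENNReal.one_sub_inv_two, inv_inv,
            ENNReal.inv_mul_cancel (by simp) (by simp)]
  have hcauchy : ∀ᵐ x ∂P, CauchySeq x := by
    filter_upwards [ae_lt_top (hG 0) ((hGint 0).trans_lt ENNReal.one_lt_top).ne] with x hx
    refine h.cauchySeq_of_tsum_wCost_ne_top x ?_
    simpa [G] using hx.ne
  obtain ⟨L, hL, hlim⟩ := measurable_limit_of_tendsto_metrizable_ae (μ := P) (L := atTop)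
    (f := fun n (x : ℕ → X) ↦ x n) (fun n ↦ (measurable_pi_apply n).aemeasurable)
    (hcauchy.mono fun x hx ↦ cauchySeq_tendsto_of_complete hx)
  have hmarg (n : ℕ) : P.map (fun x ↦ x n) = ν n := by
    rw [← (hq n).2.1, ← hPq, Measure.map_map (by fun_prop) (by fun_prop)]; rfl
  refine ⟨P.map L, fun n ↦ ⟨P.map fun x ↦ (x n, L x), ?_, ?_⟩⟩
  · rw [← hmarg n]
    exact mem_couplings_map (measurable_pi_apply n) hL
  rw [lintegral_map (h.measurable_wCost (by positivity)) (by fun_prop)]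
  refine (lintegral_mono_ae ?_).trans (hGint n)
  filter_upwards [hlim] with x hx
  have hx' : Tendsto (fun j ↦ x (n + j)) atTop (𝓝 (L x)) := by
    simpa only [add_comm n] using (tendsto_add_atTop_iff_nat n).2 hx
  have hc := (h.continuous_wCost (X := X) (s := 2 * 2⁻¹ ^ n) (by positivity)).tendsto (x n, L x)
  exact le_of_tendsto' (hc.comp (tendsto_const_nhds.prodMk_nhds hx'))
    fun j ↦ h.wCost_le_tsum x j n

end WTheta

/-- Completeness of the `L^θ`-Wasserstein space: every `W_θ`-Cauchy sequence in `P_θ(X)`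
converges in `W_θ` to some element of `P_θ(X)`. -/
theorem WTheta_complete
    {X : Type*} [MetricSpace X] [CompleteSpace X] [TopologicalSpace.SeparableSpace X]
    [MeasurableSpace X] [BorelSpace X]
    (θ φ ψ : ℝ → ℝ) (hfact : CCFactorization θ φ ψ)
    (μs : ℕ → Measure X) (hmem : ∀ k, MemPTheta φ ψ (μs k))
    (hcauchy : ∀ ε : ℝ≥0∞, 0 < ε → ∃ N : ℕ, ∀ m ≥ N, ∀ n ≥ N,
      WTheta φ ψ (μs m) (μs n) < ε) :
    ∃ μ : Measure X, MemPTheta φ ψ μ ∧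
      Tendsto (fun k => WTheta φ ψ (μs k) μ) atTop (𝓝 0) := by
  have hsc : SecondCountableTopology X := UniformSpace.secondCountable_of_separable X
  have hpos : ∀ n : ℕ, (0 : ℝ) < 2⁻¹ ^ n := fun n ↦ by positivity
  choose N hN using fun n : ℕ ↦ hcauchy (ENNReal.ofReal (2⁻¹ ^ (n + 1)))
    (ENNReal.ofReal_pos.2 (hpos _))
  have hcoup (n a b : ℕ) (ha : N n ≤ a) (hb : N n ≤ b) :
      ∃ q ∈ Couplings (μs a) (μs b), ∫⁻ p, wCost φ ψ (2⁻¹ ^ n) p.1 p.2 ∂q ≤ 1 := by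
    have e : (2⁻¹ : ℝ) ^ n = 2 * 2⁻¹ ^ (n + 1) := by rw [pow_succ]; ring
    rw [e]
    exact exists_coupling_of_WTheta_lt hfact (hN n a ha b hb)
  let K (n : ℕ) : ℕ := ∑ i ∈ Finset.range (n + 1), N i
  have hK (n : ℕ) : N n ≤ K n :=
    Finset.single_le_sum (f := N) (fun _ _ ↦ Nat.zero_le _) (Finset.self_mem_range_succ n)
  have hK' (n : ℕ) : K n ≤ K (n + 1) := by
    simp only [K, Finset.sum_range_succ _ (n + 1), Nat.le_add_right]
  choose q hq hqle using fun n ↦ hcoup n (K n) (K (n + 1)) (hK n) ((hK n).trans (hK' n))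
  obtain ⟨μ, hμ⟩ := exists_limit_of_chain hfact (ν := fun n ↦ μs (K n)) hq hqle
  refine ⟨μ, ?_, ?_⟩
  · obtain ⟨p, hp, hple⟩ := hμ 0
    exact (hmem _).of_coupling hfact hp (by positivity) hple
  have hbound (n k : ℕ) (hk : N n ≤ k) :
      WTheta φ ψ (μs k) μ ≤ ENNReal.ofReal (2 * (2 * 2⁻¹ ^ n)) := by
    obtain ⟨p, hp, hple⟩ := hμ n
    obtain ⟨p', hp', hple'⟩ := hcoup n k (K n) hk (hK n)
    have hple'' : ∫⁻ x, wCost φ ψ (2 * 2⁻¹ ^ n) x.1 x.2 ∂p' ≤ 1 :=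
      (lintegral_mono fun x ↦ hfact.wCost_anti (hpos n) (by linarith [hpos n]) _ _).trans hple'
    obtain ⟨r, hr, hrle⟩ := exists_coupling_trans hfact hp' hp (by positivity) hple'' hple
    exact WTheta_le_of_coupling hr (by positivity) hrle
  have hlim : Tendsto (fun n : ℕ ↦ ENNReal.ofReal (2 * (2 * 2⁻¹ ^ n))) atTop (𝓝 0) := by
    have : Tendsto (fun n : ℕ ↦ (2 * (2 * 2⁻¹ ^ n) : ℝ)) atTop (𝓝 (2 * (2 * 0))) :=
      ((tendsto_pow_atTop_nhds_zero_of_lt_one (by norm_num) (by norm_num)).const_mul _).const_mul _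
    simpa using ENNReal.tendsto_ofReal this
  refine ENNReal.tendsto_nhds_zero.2 fun ε hε ↦ ?_
  obtain ⟨n, hn⟩ := (hlim.eventually (gt_mem_nhds hε)).exists
  filter_upwards [eventually_ge_atTop (N n)] with k hk
  exact (hbound n k hk).trans hn.le
end
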